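/- Let H=(X,R) be an I-type hypergraph with a unique-max coloring c. For any finite family of ranges that pairwise intersect only if their maximum color differs: if r₁,r₂∈R intersect and the point of maximum color in r₁ differs from the point of maximum color in r₂, then max{c(x):x∈r₁} ≠ max{c(x):x∈r₂}. -/

import Mathlib

/-- A hypergraph (ranges `R` over ground set `X`) is I-type if the union of two
intersecting ranges is a range. -/
def IType {X : Type*} [DecidableEq X] (R : Set (Finset X)) : Prop :=
  ∀ r₁ ∈ R, ∀ r₂ ∈ R, (r₁ ∩ r₂).Nonempty → r₁ ∪ r₂ ∈ R

/-- A coloring is unique-max if every range has exactly one point achieving the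
maximum color within the range. -/
def UniqueMax {X : Type*} (R : Set (Finset X)) (c : X → ℕ) : Prop :=
  ∀ r ∈ R, ∃! x, x ∈ r ∧ c x = r.sup c

/-- In an I-type hypergraph with a unique-max coloring, if two ranges intersect
and their unique maximum-color points differ, then their maximum colors differ. -/
theorem iType_uniqueMax_distinct_colors {X : Type*} [DecidableEq X]
    (R : Set (Finset X)) (hI : IType R) (c : X → ℕ) (hum : UniqueMax R c)
    (r₁ r₂ : Finset X) (hr₁ : r₁ ∈ R) (hr₂ : r₂ ∈ R)
    (hint : (r₁ ∩ r₂).Nonempty)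
    (x₁ x₂ : X) (hx₁ : x₁ ∈ r₁ ∧ c x₁ = r₁.sup c) (hx₂ : x₂ ∈ r₂ ∧ c x₂ = r₂.sup c)
    (hne : x₁ ≠ x₂) :
    r₁.sup c ≠ r₂.sup c := by
  intro heq
  have hsup : (r₁ ∪ r₂).sup c = r₁.sup c := by
    rw [Finset.sup_union, ← heq, sup_idem]
  exact hne ((hum _ (hI r₁ hr₁ r₂ hr₂ hint)).unique
    ⟨Finset.mem_union_left _ hx₁.1, hx₁.2.trans hsup.symm⟩
    ⟨Finset.mem_union_right _ hx₂.1, hx₂.2.trans (heq.symm.trans hsup.symm)⟩)
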